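/- Let f : ℝ → ℝ be 2π-periodic with |f(θ)| ≤ M for all θ, where M ≥ 1, and let g : ℝ → ℝ be 2π-periodic and Lipschitz. Then there exists C₀ > 0, depending only on M, such that for all ε ∈ (0, 1/(2M)] and all θ ∈ [0,2π]: | Σ_{n=1}^∞ [ 1 − ((1−εM)/(1+εf(θ)))^n ] ( â_n(g) cos nθ + b̂_n(g) sin nθ ) | ≤ C₀ ‖g'‖_{L²([0,2π])} ε^{1/2}, where g' is the derivative of g. -/

import Mathlib

open Real MeasureTheory Set Filter

/-- Fourier cosine coefficient `â_n(g) = (1/π)∫₀^{2π} g(θ) cos(nθ) dθ`. -/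
noncomputable def aHat (g : ℝ → ℝ) (n : ℕ) : ℝ :=
  (1 / π) * ∫ θ in (0:ℝ)..(2 * π), g θ * Real.cos (n * θ)

/-- Fourier sine coefficient `b̂_n(g) = (1/π)∫₀^{2π} g(θ) sin(nθ) dθ`. -/
noncomputable def bHat (g : ℝ → ℝ) (n : ℕ) : ℝ :=
  (1 / π) * ∫ θ in (0:ℝ)..(2 * π), g θ * Real.sin (n * θ)

/-- Dirichlet-to-Neumann operator of the unit disk for exterior harmonic
functions: `N₀(Ψ)(θ) = −Σ_{n≥1} n (â_n(Ψ) cos nθ + b̂_n(Ψ) sin nθ)`. -/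
noncomputable def N0 (Ψ : ℝ → ℝ) (θ : ℝ) : ℝ :=
  -∑' n : ℕ, ((n : ℝ) + 1) *
    (aHat Ψ (n + 1) * Real.cos (((n : ℝ) + 1) * θ) +
     bHat Ψ (n + 1) * Real.sin (((n : ℝ) + 1) * θ))

/-- `D₀(Ψ)(θ) = −Σ_{n≥1} (n+1)(â_n(Ψ) cos nθ + b̂_n(Ψ) sin nθ)`. -/
noncomputable def D0 (Ψ : ℝ → ℝ) (θ : ℝ) : ℝ :=
  -∑' n : ℕ, ((n : ℝ) + 2) *
    (aHat Ψ (n + 1) * Real.cos (((n : ℝ) + 1) * θ) +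
     bHat Ψ (n + 1) * Real.sin (((n : ℝ) + 1) * θ))

/-- `u` is harmonic on `s ⊆ ℝ²`: twice continuously differentiable with
vanishing Laplacian `∂²u/∂x² + ∂²u/∂y² = 0` on `s`. -/
def HarmonicOnSet (u : ℝ × ℝ → ℝ) (s : Set (ℝ × ℝ)) : Prop :=
  ContDiffOn ℝ 2 u s ∧ ∀ x ∈ s,
    iteratedFDeriv ℝ 2 u x ![((1:ℝ), (0:ℝ)), ((1:ℝ), (0:ℝ))] +
      iteratedFDeriv ℝ 2 u x ![((0:ℝ), (1:ℝ)), ((0:ℝ), (1:ℝ))] = 0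

/-- The closed perturbed disk `D̄_ε` with boundary
`{(1+εf(θ))(cos θ, sin θ)}`. -/
def Dbar (ε : ℝ) (f : ℝ → ℝ) : Set (ℝ × ℝ) :=
  {x | ∃ ρ θ : ℝ, 0 ≤ ρ ∧ ρ ≤ 1 + ε * f θ ∧
    x = (ρ * Real.cos θ, ρ * Real.sin θ)}

/-- Sup norm of `|g|` over `[0, 2π]`. -/
noncomputable def supIcc (g : ℝ → ℝ) : ℝ :=
  ⨆ θ ∈ Set.Icc (0:ℝ) (2 * π), |g θ|

/-- `‖Ψ‖_{C⁴}`: max of the sup norms of `Ψ` and its first four derivatives. -/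
noncomputable def C4norm (Ψ : ℝ → ℝ) : ℝ :=
  ⨆ i ∈ Finset.range 5, supIcc (iteratedDeriv i Ψ)

/-- `M = max(‖f‖_∞, ‖f'‖_∞, 1)`. -/
noncomputable def Mconst (f : ℝ → ℝ) : ℝ :=
  max (max (supIcc f) (supIcc (deriv f))) 1

/-- `u₀^{εM}(r,θ) = Σ_{n≥0} ((1−εM)/r)^n (â_n(Ψ) cos nθ + b̂_n(Ψ) sin nθ)`. -/
noncomputable def u0eM (Ψ : ℝ → ℝ) (ε M r θ : ℝ) : ℝ :=
  ∑' n : ℕ, ((1 - ε * M) / r) ^ n *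
    (aHat Ψ n * Real.cos (n * θ) + bHat Ψ n * Real.sin (n * θ))

/-- `u₁^{εM}(r,θ) = −Σ_{n≥0} ((1−εM)/r)^n (â_n((f+M)N₀Ψ) cos nθ + b̂_n((f+M)N₀Ψ) sin nθ)`. -/
noncomputable def u1eM (f Ψ : ℝ → ℝ) (ε M r θ : ℝ) : ℝ :=
  -∑' n : ℕ, ((1 - ε * M) / r) ^ n *
    (aHat (fun t => (f t + M) * N0 Ψ t) n * Real.cos (n * θ) +
     bHat (fun t => (f t + M) * N0 Ψ t) n * Real.sin (n * θ))

/-- `u₀(r,θ) = Σ_{n≥0} r^{−n} (â_n(Ψ) cos nθ + b̂_n(Ψ) sin nθ)`. -/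
noncomputable def u0ser (Ψ : ℝ → ℝ) (r θ : ℝ) : ℝ :=
  ∑' n : ℕ, r ^ (-(n : ℤ)) *
    (aHat Ψ n * Real.cos (n * θ) + bHat Ψ n * Real.sin (n * θ))

/-- `2π`-periodic endpoints and Lipschitz: cosine coefficients of `g'`. -/
theorem aux_aHat_deriv {g : ℝ → ℝ} {K : NNReal} (hp : Function.Periodic g (2 * π))
    (hg : LipschitzWith K g) (n : ℕ) : aHat (deriv g) n = n * bHat g n := by
  have hga : AbsolutelyContinuousOnInterval g 0 (2 * π) :=
    (hg.lipschitzOnWith (s := uIcc 0 (2 * π))).absolutelyContinuousOnInterval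
  have hd : deriv (fun x : ℝ => Real.cos (n * x)) = fun x => -Real.sin (n * x) * n := by
    funext x
    exact ((hasDerivAt_id x).const_mul (n : ℝ)).cos.deriv.trans (by simp)
  have hL : LipschitzWith (n : NNReal) (fun x : ℝ => Real.cos (n * x)) := by
    apply lipschitzWith_of_nnnorm_deriv_le (by fun_prop)
    intro x
    rw [hd, ← NNReal.coe_le_coe]
    simp only [coe_nnnorm, norm_mul, norm_neg, Real.norm_eq_abs, NNReal.coe_natCast, Nat.abs_cast]
    exact mul_le_of_le_one_left (by positivity) (Real.abs_sin_le_one _)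
  have hca : AbsolutelyContinuousOnInterval (fun x : ℝ => Real.cos (n * x)) 0 (2 * π) :=
    (hL.lipschitzOnWith (s := uIcc 0 (2 * π))).absolutelyContinuousOnInterval
  have h := hca.integral_mul_deriv_eq_deriv_mul hga
  have hp0 : g (2 * π) = g 0 := by simpa using hp 0
  rw [hd, hp0] at h
  have hc : Real.cos (n * (2 * π)) = 1 := Real.cos_nat_mul_two_pi n
  simp only [hc, mul_zero, Real.cos_zero, sub_self, zero_sub] at h
  unfold aHat bHat
  have e1 : (∫ θ in (0:ℝ)..(2 * π), deriv g θ * Real.cos (n * θ)) =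
      ∫ θ in (0:ℝ)..(2 * π), Real.cos (n * θ) * deriv g θ := by simp only [mul_comm]
  have e2 : (∫ x in (0:ℝ)..(2 * π), -Real.sin (n * x) * n * g x) =
      -(n * ∫ θ in (0:ℝ)..(2 * π), g θ * Real.sin (n * θ)) := by
    rw [← intervalIntegral.integral_const_mul, ← intervalIntegral.integral_neg]
    congr 1; funext x; ring
  rw [e1, h, e2]; ring

theorem aux_bHat_deriv {g : ℝ → ℝ} {K : NNReal} (hp : Function.Periodic g (2 * π))
    (hg : LipschitzWith K g) (n : ℕ) : bHat (deriv g) n = -(n * aHat g n) := by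
  have hga : AbsolutelyContinuousOnInterval g 0 (2 * π) :=
    (hg.lipschitzOnWith (s := uIcc 0 (2 * π))).absolutelyContinuousOnInterval
  have hd : deriv (fun x : ℝ => Real.sin (n * x)) = fun x => Real.cos (n * x) * n := by
    funext x
    exact ((hasDerivAt_id x).const_mul (n : ℝ)).sin.deriv.trans (by simp)
  have hL : LipschitzWith (n : NNReal) (fun x : ℝ => Real.sin (n * x)) := by
    apply lipschitzWith_of_nnnorm_deriv_le (by fun_prop)
    intro x
    rw [hd, ← NNReal.coe_le_coe]
    simp only [coe_nnnorm, norm_mul, Real.norm_eq_abs, NNReal.coe_natCast, Nat.abs_cast]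
    exact mul_le_of_le_one_left (by positivity) (Real.abs_cos_le_one _)
  have hca : AbsolutelyContinuousOnInterval (fun x : ℝ => Real.sin (n * x)) 0 (2 * π) :=
    (hL.lipschitzOnWith (s := uIcc 0 (2 * π))).absolutelyContinuousOnInterval
  have h := hca.integral_mul_deriv_eq_deriv_mul hga
  have hp0 : g (2 * π) = g 0 := by simpa using hp 0
  rw [hd, hp0] at h
  have hc : Real.sin (n * (2 * π)) = 0 := by
    have := Real.sin_nat_mul_pi (2 * n)
    push_cast at this
    rw [← this]; congr 1; ring
  simp only [hc, mul_zero, Real.sin_zero, zero_mul, sub_self, zero_sub] at h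
  unfold aHat bHat
  have e1 : (∫ θ in (0:ℝ)..(2 * π), deriv g θ * Real.sin (n * θ)) =
      ∫ θ in (0:ℝ)..(2 * π), Real.sin (n * θ) * deriv g θ := by simp only [mul_comm]
  have e2 : (∫ x in (0:ℝ)..(2 * π), Real.cos (n * x) * n * g x) =
      (n * ∫ θ in (0:ℝ)..(2 * π), g θ * Real.cos (n * θ)) := by
    rw [← intervalIntegral.integral_const_mul]
    congr 1; funext x; ring
  rw [e1, h, e2]; ring

theorem aux_coeff {h : ℝ → ℝ} (hab : (0:ℝ) < 2 * π)
    (hi : IntervalIntegrable h volume 0 (2 * π)) (n : ℕ) :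
    ‖fourierCoeffOn hab (fun x => (h x : ℂ)) (n : ℤ)‖ ^ 2 =
      ((aHat h n) ^ 2 + (bHat h n) ^ 2) / 4 := by
  have hA : IntervalIntegrable (fun x => h x * Real.cos (n * x)) volume 0 (2 * π) :=
    hi.mul_continuousOn (by fun_prop)
  have hB : IntervalIntegrable (fun x => h x * Real.sin (n * x)) volume 0 (2 * π) :=
    hi.mul_continuousOn (by fun_prop)
  have hA' : IntervalIntegrable (fun x => ((h x * Real.cos (n * x) : ℝ) : ℂ)) volume 0 (2 * π) :=
    ⟨hA.1.ofReal, hA.2.ofReal⟩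
  have hB' : IntervalIntegrable (fun x => ((h x * Real.sin (n * x) : ℝ) : ℂ)) volume 0 (2 * π) :=
    ⟨hB.1.ofReal, hB.2.ofReal⟩
  have key : fourierCoeffOn hab (fun x => (h x : ℂ)) (n : ℤ) =
      ((aHat h n / 2 : ℝ) : ℂ) + ((-(bHat h n / 2) : ℝ) : ℂ) * Complex.I := by
    rw [fourierCoeffOn_eq_integral]
    have e : ∀ x : ℝ, (fourier (-(n:ℤ)) (x : AddCircle (2 * π - 0)) : ℂ) • (h x : ℂ) =
        ((h x * Real.cos (n * x) : ℝ) : ℂ) - Complex.I * ((h x * Real.sin (n * x) : ℝ) : ℂ) := by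
      intro x
      rw [fourier_coe_apply]
      have : 2 * (π:ℂ) * Complex.I * ((-(n:ℤ) : ℤ) : ℂ) * x / ((2 * π - 0 : ℝ) : ℂ) =
          (-((n:ℂ) * x)) * Complex.I := by
        have hpi : (π:ℂ) ≠ 0 := by exact_mod_cast Real.pi_ne_zero
        push_cast
        rw [sub_zero]
        field_simp
      rw [this, Complex.exp_mul_I]
      simp only [Complex.cos_neg, Complex.sin_neg, smul_eq_mul]
      push_cast
      ring
    simp_rw [e]
    rw [intervalIntegral.integral_sub hA' (hB'.const_mul _),
      intervalIntegral.integral_const_mul, intervalIntegral.integral_ofReal,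
      intervalIntegral.integral_ofReal]
    unfold aHat bHat
    have hpi : (π:ℂ) ≠ 0 := by exact_mod_cast Real.pi_ne_zero
    rw [Complex.real_smul]
    push_cast
    field_simp
    ring
  rw [key, ← Complex.normSq_eq_norm_sq, Complex.normSq_add_mul_I]
  ring

theorem aux_bessel {h : ℝ → ℝ} (hm : Measurable h) {K : ℝ} (hK : ∀ x, ‖h x‖ ≤ K) (N : ℕ) :
    ∑ i ∈ Finset.range N, ((aHat h (i + 1)) ^ 2 + (bHat h (i + 1)) ^ 2) ≤
      ∫ x in (0:ℝ)..(2 * π), (h x) ^ 2 := by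
  have hab : (0:ℝ) < 2 * π := by positivity
  have hi : IntervalIntegrable h volume 0 (2 * π) := by
    rw [intervalIntegrable_iff_integrableOn_Ioc_of_le hab.le]
    exact Measure.integrableOn_of_bounded (M := K) measure_Ioc_lt_top.ne hm.aestronglyMeasurable
      (Eventually.of_forall hK)
  have hL2 : MemLp (fun x => (h x : ℂ)) 2 (volume.restrict (Ioc 0 (2 * π))) := by
    refine MemLp.of_bound (by fun_prop) K (Eventually.of_forall fun x => ?_)
    simpa using hK x
  have hs := hasSum_sq_fourierCoeffOn hab hL2
  have hinj : Function.Injective (fun i : ℕ => ((i + 1 : ℕ) : ℤ)) := by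
    intro a b hab; simpa using hab
  have hle := sum_le_hasSum ((Finset.range N).map ⟨_, hinj⟩) (fun i _ => by positivity) hs
  rw [Finset.sum_map] at hle
  simp only [Function.Embedding.coeFn_mk, aux_coeff hab hi, ← Finset.sum_div] at hle
  simp only [Complex.norm_real, Real.norm_eq_abs, sq_abs, smul_eq_mul, sub_zero] at hle
  have h0 : 0 ≤ ∫ x in (0:ℝ)..(2 * π), (h x) ^ 2 :=
    intervalIntegral.integral_nonneg hab.le fun x _ => sq_nonneg _
  have hpi : (2 * π)⁻¹ ≤ 1 / 4 := by
    rw [one_div]; exact inv_anti₀ (by norm_num) (by linarith [Real.pi_gt_three])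
  nlinarith [mul_le_mul_of_nonneg_right hpi h0]

theorem aux_tele {K : ℝ} (hK : 0 < K) (N : ℕ) :
    ∑ i ∈ Finset.range N, (2 / ((i:ℝ) + 1 + K)) ^ 2 ≤ 4 / K := by
  have : ∑ i ∈ Finset.range N, (2 / ((i:ℝ) + 1 + K)) ^ 2 ≤ 4 / K - 4 / (N + K) := by
    induction N with
    | zero => simp
    | succ n ih =>
      rw [Finset.sum_range_succ]
      have : (2 / ((n:ℝ) + 1 + K)) ^ 2 ≤ 4 / (n + K) - 4 / (n + 1 + K) := by
        have h1 : 0 < (n:ℝ) + K := by positivity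
        have e : 4 / ((n:ℝ) + K) - 4 / (n + 1 + K) = 4 / ((n + K) * (n + 1 + K)) := by
          field_simp; ring
        rw [e, div_pow]
        have h2 : ((n:ℝ) + K) * (n + 1 + K) ≤ (n + 1 + K) ^ 2 := by nlinarith
        norm_num
        gcongr
      push_cast
      linarith
  have h2 : 0 ≤ 4 / ((N:ℝ) + K) := by positivity
  linarith

theorem aux_weight {x δ : ℝ} (hδ : 0 < δ) (hx0 : 0 ≤ x) (hx1 : x ≤ 1) (hx : 1 - x ≤ δ) (n : ℕ) :
    0 ≤ 1 - x ^ (n + 1) ∧ 1 - x ^ (n + 1) ≤ ((n:ℝ) + 1) * (2 / ((n:ℝ) + 1 + 1 / δ)) := by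
  have h1 : x ^ (n + 1) ≤ 1 := pow_le_one₀ hx0 hx1
  have h0 : 0 ≤ x ^ (n + 1) := by positivity
  have hb := one_add_mul_le_pow (a := x - 1) (by linarith) (n + 1)
  push_cast at hb
  rw [add_sub_cancel] at hb
  have hn : (0:ℝ) < (n:ℝ) + 1 := by positivity
  have h2 : 1 - x ^ (n + 1) ≤ ((n:ℝ) + 1) * δ := by nlinarith
  refine ⟨by linarith, ?_⟩
  rw [← mul_div_assoc, le_div_iff₀ (by positivity)]
  have h3 : (1 - x ^ (n + 1)) * (1 / δ) ≤ (n:ℝ) + 1 := by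
    rw [mul_one_div, div_le_iff₀ hδ]; exact h2
  nlinarith

theorem aux_trig (A B t : ℝ) : |A * Real.cos t + B * Real.sin t| ≤ √(A ^ 2 + B ^ 2) := by
  apply Real.abs_le_sqrt
  nlinarith [sq_nonneg (A * Real.sin t - B * Real.cos t), Real.sin_sq_add_cos_sq t]

/-- estimate of `Σ_{n≥1} [1 − ((1−εM)/(1+εf))^n](â_n(g)cos nθ + b̂_n(g)sin nθ)`
by `C₀ ‖g'‖_{L²} ε^{1/2}`, with `C₀` depending only on `M`. -/
theorem termII_estimate (M : ℝ) (hM : 1 ≤ M) :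
    ∃ C₀ > (0:ℝ), ∀ f g : ℝ → ℝ,
      Function.Periodic f (2 * π) → (∀ θ : ℝ, |f θ| ≤ M) →
      Function.Periodic g (2 * π) → (∃ K : NNReal, LipschitzWith K g) →
      ∀ ε : ℝ, 0 < ε → ε ≤ 1 / (2 * M) →
        ∀ θ ∈ Set.Icc (0:ℝ) (2 * π),
          |∑' n : ℕ, (1 - ((1 - ε * M) / (1 + ε * f θ)) ^ (n + 1)) *
              (aHat g (n + 1) * Real.cos (((n : ℝ) + 1) * θ) +
               bHat g (n + 1) * Real.sin (((n : ℝ) + 1) * θ))|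
            ≤ C₀ * Real.sqrt (∫ θ' in (0:ℝ)..(2 * π), (deriv g θ') ^ 2)
                * ε ^ ((1:ℝ)/2) := by
  refine ⟨4 * √M, by positivity, ?_⟩
  intro f g _ hf hp ⟨K, hg⟩ ε hε hεM θ _
  have hM0 : 0 < M := by linarith
  have hεM' : ε * M ≤ 1 / 2 := by
    rw [le_div_iff₀ (by positivity)] at hεM; linarith
  obtain ⟨hf1, hf2⟩ := abs_le.1 (hf θ)
  have hden : 1 / 2 ≤ 1 + ε * f θ := by nlinarith
  set x := (1 - ε * M) / (1 + ε * f θ) with hxdef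
  have hx0 : 0 ≤ x := div_nonneg (by linarith) (by linarith)
  have hx1 : x ≤ 1 := by rw [hxdef, div_le_one (by linarith)]; nlinarith
  have hδ : 0 < 4 * M * ε := by positivity
  have hxδ : 1 - x ≤ 4 * M * ε := by
    have : 1 - 4 * M * ε ≤ x := by
      rw [hxdef, le_div_iff₀ (by linarith)]
      nlinarith [mul_le_mul_of_nonneg_left hden hδ.le, mul_le_mul_of_nonneg_left hf2 hε.le]
    linarith
  have hbes := aux_bessel (measurable_deriv g) (K := K)
    (fun x => norm_deriv_le_of_lipschitz hg)
  set I := ∫ θ' in (0:ℝ)..(2 * π), (deriv g θ') ^ 2 with hI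
  set t : ℕ → ℝ := fun n => (1 - x ^ (n + 1)) *
      (aHat g (n + 1) * Real.cos (((n : ℝ) + 1) * θ) +
        bHat g (n + 1) * Real.sin (((n : ℝ) + 1) * θ)) with ht
  have hterm : ∀ n, |t n| ≤ (2 / ((n:ℝ) + 1 + 1 / (4 * M * ε))) *
      √(aHat (deriv g) (n + 1) ^ 2 + bHat (deriv g) (n + 1) ^ 2) := by
    intro n
    obtain ⟨w0, w1⟩ := aux_weight hδ hx0 hx1 hxδ n
    rw [ht]
    simp only [abs_mul, abs_of_nonneg w0]
    have hs : √(aHat (deriv g) (n + 1) ^ 2 + bHat (deriv g) (n + 1) ^ 2) =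
        ((n:ℝ) + 1) * √(aHat g (n + 1) ^ 2 + bHat g (n + 1) ^ 2) := by
      rw [aux_aHat_deriv hp hg, aux_bHat_deriv hp hg]
      have : ((((n + 1 : ℕ) : ℝ) * bHat g (n + 1)) ^ 2 + (-(((n + 1 : ℕ) : ℝ) * aHat g (n + 1))) ^ 2)
        = ((n:ℝ) + 1) ^ 2 * (aHat g (n + 1) ^ 2 + bHat g (n + 1) ^ 2) := by push_cast; ring
      rw [this, Real.sqrt_mul (by positivity), Real.sqrt_sq (by positivity)]
    rw [hs]
    calc _ ≤ (((n:ℝ) + 1) * (2 / ((n:ℝ) + 1 + 1 / (4 * M * ε)))) *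
          √(aHat g (n + 1) ^ 2 + bHat g (n + 1) ^ 2) :=
          mul_le_mul w1 (aux_trig _ _ _) (abs_nonneg _) (w0.trans w1)
      _ = _ := by ring
  have hpart : ∀ N, ∑ i ∈ Finset.range N, |t i| ≤ 4 * √M * √I * ε ^ ((1:ℝ)/2) := by
    intro N
    refine (Finset.sum_le_sum fun i _ => hterm i).trans ?_
    refine (Real.sum_mul_le_sqrt_mul_sqrt _ _ _).trans ?_
    have e1 : √(4 / (1 / (4 * M * ε))) = 4 * √M * ε ^ ((1:ℝ)/2) := by
      rw [← Real.sqrt_eq_rpow]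
      have : 4 / (1 / (4 * M * ε)) = 4 ^ 2 * (M * ε) := by field_simp
      rw [this, Real.sqrt_mul (by positivity), Real.sqrt_mul hM0.le,
        Real.sqrt_sq (by norm_num)]
      ring
    have s1 := Real.sqrt_le_sqrt (aux_tele (K := 1 / (4 * M * ε)) (by positivity) N)
    rw [e1] at s1
    have s2 : √(∑ i ∈ Finset.range N,
        √(aHat (deriv g) (i + 1) ^ 2 + bHat (deriv g) (i + 1) ^ 2) ^ 2) ≤ √I := by
      apply Real.sqrt_le_sqrt
      refine le_trans (le_of_eq ?_) (hbes N)
      exact Finset.sum_congr rfl fun i _ => Real.sq_sqrt (by positivity)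
    calc _ ≤ (4 * √M * ε ^ ((1:ℝ)/2)) * √I :=
          mul_le_mul s1 s2 (Real.sqrt_nonneg _) (by positivity)
      _ = _ := by ring
  have hsum : Summable fun n => ‖t n‖ := summable_of_sum_range_le (fun _ => norm_nonneg _) hpart
  exact (norm_tsum_le_tsum_norm hsum).trans
    (Real.tsum_le_of_sum_range_le (fun _ => norm_nonneg _) hpart)
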